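/- Let θ(z) be holomorphic at 0 ∈ ℂ^N with values in [U,Y], with a zero of multiplicity m > 0 at 0. Then there exist separable Hilbert spaces U⁽⁰⁾ = U, U⁽¹⁾,…,U⁽ᵐ⁾, operators R_k^{(j)} : U⁽ʲ⁻¹⁾ → U⁽ʲ⁾ (j = 1,…,m; k = 1,…,N), and a holomorphic [U⁽ᵐ⁾,Y]-valued function ψ with ψ(0) ≠ 0, such that θ(z) = ψ(z)(zR⁽ᵐ⁾)⋯(zR⁽¹⁾) in a neighborhood of 0 (right-hand analogue of the linear-factor extraction theorem). -/

import Mathlib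

noncomputable section

open scoped ComplexConjugate

/-- A bundled separable complex Hilbert space. -/
structure HilbertSp : Type 1 where
  carrier : Type
  [iN : NormedAddCommGroup carrier]
  [iI : InnerProductSpace ℂ carrier]
  [iC : CompleteSpace carrier]
  [iS : TopologicalSpace.SeparableSpace carrier]

attribute [instance] HilbertSp.iN HilbertSp.iI HilbertSp.iC HilbertSp.iS

variable {N : ℕ}

/-- The linear pencil `z ↦ Σₖ z_k T_k` associated with an `N`-tuple of operators. -/
def pencil {E F : Type*} [NormedAddCommGroup E] [NormedAddCommGroup F]
    [NormedSpace ℂ E] [NormedSpace ℂ F]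
    (T : Fin N → (E →L[ℂ] F)) (z : Fin N → ℂ) : E →L[ℂ] F := ∑ k, z k • T k

/-- membership in the unit torus `𝕋^N` -/
def onTorus (ζ : Fin N → ℂ) : Prop := ∀ k, ‖ζ k‖ = 1

/-- membership in the open unit polydisk `𝔻^N` -/
def inPolydisk (z : Fin N → ℂ) : Prop := ∀ k, ‖z k‖ < 1

/-- `θ` has a zero of multiplicity `m` at `z = 0`: it is holomorphic near `0` and the
homogeneous terms of its Taylor expansion of degree `< m` vanish while that of degree `m`
does not. -/
def HasZeroOfOrder {U Y : Type*} [NormedAddCommGroup U] [NormedAddCommGroup Y]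
    [NormedSpace ℂ U] [NormedSpace ℂ Y]
    (θ : (Fin N → ℂ) → (U →L[ℂ] Y)) (m : ℕ) : Prop :=
  ∃ p : FormalMultilinearSeries ℂ (Fin N → ℂ) (U →L[ℂ] Y),
    HasFPowerSeriesAt θ p 0 ∧ (∀ j, j < m → ∀ z : Fin N → ℂ, (p j) (fun _ => z) = 0) ∧
      (∃ z : Fin N → ℂ, (p m) (fun _ => z) ≠ 0)

/-- The product `(zL⁽¹⁾)(zL⁽²⁾)⋯(zL⁽ᵐ⁾) : Ysp m → Ysp 0` of linear pencils along a chain of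
spaces, where `L j k : Ysp (j+1) → Ysp j` plays the role of `L_k^{(j+1)}`. -/
def chainMul {Ysp : ℕ → Type*} [∀ j, NormedAddCommGroup (Ysp j)] [∀ j, NormedSpace ℂ (Ysp j)]
    (L : (j : ℕ) → Fin N → (Ysp (j + 1) →L[ℂ] Ysp j)) (z : Fin N → ℂ) :
    (m : ℕ) → (Ysp m →L[ℂ] Ysp 0)
  | 0 => ContinuousLinearMap.id ℂ (Ysp 0)
  | (m + 1) => (chainMul L z m).comp (pencil (L m) z)

/-- The product `(zR⁽ᵐ⁾)⋯(zR⁽¹⁾) : Usp 0 → Usp m` of linear pencils along a chain of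
spaces, where `R j k : Usp j → Usp (j+1)` plays the role of `R_k^{(j+1)}`. -/
def chainMulR {Usp : ℕ → Type*} [∀ j, NormedAddCommGroup (Usp j)] [∀ j, NormedSpace ℂ (Usp j)]
    (R : (j : ℕ) → Fin N → (Usp j →L[ℂ] Usp (j + 1))) (z : Fin N → ℂ) :
    (m : ℕ) → (Usp 0 →L[ℂ] Usp m)
  | 0 => ContinuousLinearMap.id ℂ (Usp 0)
  | (m + 1) => (pencil (R m) z).comp (chainMulR R z m)

/-- the Hilbert space direct sum `E ⊕ F` -/
abbrev hS (E F : Type*) := WithLp 2 (E × F)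

section blocks

variable (E F : Type*) [NormedAddCommGroup E] [NormedAddCommGroup F]
  [NormedSpace ℂ E] [NormedSpace ℂ F]

/-- inclusion of the first summand -/
def inlL : E →L[ℂ] hS E F :=
  ((WithLp.prodContinuousLinearEquiv 2 ℂ E F).symm : E × F →L[ℂ] hS E F).comp
    (ContinuousLinearMap.inl ℂ E F)

/-- inclusion of the second summand -/
def inrL : F →L[ℂ] hS E F :=
  ((WithLp.prodContinuousLinearEquiv 2 ℂ E F).symm : E × F →L[ℂ] hS E F).comp
    (ContinuousLinearMap.inr ℂ E F)

/-- projection onto the first summand -/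
def fstL : hS E F →L[ℂ] E :=
  (ContinuousLinearMap.fst ℂ E F).comp
    (WithLp.prodContinuousLinearEquiv 2 ℂ E F : hS E F →L[ℂ] E × F)

/-- projection onto the second summand -/
def sndL : hS E F →L[ℂ] F :=
  (ContinuousLinearMap.snd ℂ E F).comp
    (WithLp.prodContinuousLinearEquiv 2 ℂ E F : hS E F →L[ℂ] E × F)

end blocks

/-- the block operator `[[A,B],[C,D]] : X ⊕ U → X' ⊕ Y'` -/
def block2 {X U X' Y' : Type*} [NormedAddCommGroup X] [NormedAddCommGroup U]
    [NormedAddCommGroup X'] [NormedAddCommGroup Y']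
    [NormedSpace ℂ X] [NormedSpace ℂ U] [NormedSpace ℂ X'] [NormedSpace ℂ Y']
    (A : X →L[ℂ] X') (B : U →L[ℂ] X') (C : X →L[ℂ] Y') (D : U →L[ℂ] Y') :
    hS X U →L[ℂ] hS X' Y' :=
  (inlL X' Y').comp (A.comp (fstL X U)) + (inlL X' Y').comp (B.comp (sndL X U)) +
    (inrL X' Y').comp (C.comp (fstL X U)) + (inrL X' Y').comp (D.comp (sndL X U))

/-- the transfer function `θ_α(z) = zD + zC (1 - zA)⁻¹ zB` of the system
`α = (N; A, B, C, D; X, U, Y)` -/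
def transfer {X U Y : Type*} [NormedAddCommGroup X] [NormedAddCommGroup U] [NormedAddCommGroup Y]
    [NormedSpace ℂ X] [NormedSpace ℂ U] [NormedSpace ℂ Y]
    (A : Fin N → (X →L[ℂ] X)) (B : Fin N → (U →L[ℂ] X)) (C : Fin N → (X →L[ℂ] Y))
    (D : Fin N → (U →L[ℂ] Y)) (z : Fin N → ℂ) : U →L[ℂ] Y :=
  pencil D z + (pencil C z).comp ((Ring.inverse (1 - pencil A z)).comp (pencil B z))

/-- unitarity of a bounded operator between Hilbert spaces -/
def IsUnitaryOp {E F : Type*} [NormedAddCommGroup E] [InnerProductSpace ℂ E] [CompleteSpace E]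
    [NormedAddCommGroup F] [InnerProductSpace ℂ F] [CompleteSpace F] (W : E →L[ℂ] F) : Prop :=
  (ContinuousLinearMap.adjoint W).comp W = 1 ∧ W.comp (ContinuousLinearMap.adjoint W) = 1

/-- the block operator `G_α` of a system, as an `N`-tuple -/
def sysBlock {X U Y : Type*} [NormedAddCommGroup X] [NormedAddCommGroup U] [NormedAddCommGroup Y]
    [NormedSpace ℂ X] [NormedSpace ℂ U] [NormedSpace ℂ Y]
    (A : Fin N → (X →L[ℂ] X)) (B : Fin N → (U →L[ℂ] X)) (C : Fin N → (X →L[ℂ] Y))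
    (D : Fin N → (U →L[ℂ] Y)) : Fin N → (hS X U →L[ℂ] hS X Y) :=
  fun k => block2 (A k) (B k) (C k) (D k)

/-- `α` is a conservative scattering system: `ζ G_α` is unitary for every `ζ ∈ 𝕋^N`. -/
def Conservative {X U Y : Type*} [NormedAddCommGroup X] [InnerProductSpace ℂ X] [CompleteSpace X]
    [NormedAddCommGroup U] [InnerProductSpace ℂ U] [CompleteSpace U]
    [NormedAddCommGroup Y] [InnerProductSpace ℂ Y] [CompleteSpace Y]
    (A : Fin N → (X →L[ℂ] X)) (B : Fin N → (U →L[ℂ] X)) (C : Fin N → (X →L[ℂ] Y))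
    (D : Fin N → (U →L[ℂ] Y)) : Prop :=
  ∀ ζ : Fin N → ℂ, onTorus ζ → IsUnitaryOp (pencil (sysBlock A B C D) ζ)

open Filter Topology Asymptotics

section PowerSeries

variable {𝕜 E F : Type*} [NontriviallyNormedField 𝕜] [NormedAddCommGroup E] [NormedSpace 𝕜 E]
  [NormedAddCommGroup F] [NormedSpace 𝕜 F]

/-- Terms of a power series that vanish on the diagonal may be replaced by zero. -/
theorem HasFPowerSeriesAt.exists_eq_zero_of_diag_eq_zero {f : E → F}
    {p : FormalMultilinearSeries 𝕜 E F} {x : E} (hf : HasFPowerSeriesAt f p x) {m : ℕ}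
    (hp : ∀ j < m, ∀ z : E, p j (fun _ => z) = 0) :
    ∃ q : FormalMultilinearSeries 𝕜 E F,
      HasFPowerSeriesAt f q x ∧ (∀ j < m, q j = 0) ∧ q m = p m := by
  obtain ⟨r, hr⟩ := hf
  refine ⟨fun j => if j < m then 0 else p j, ⟨r, ?_, hr.r_pos, ?_⟩, ?_, ?_⟩
  · refine hr.r_le.trans (FormalMultilinearSeries.radius_le_of_le fun n => ?_)
    split_ifs <;> simp
  · intro y hy
    convert hr.hasSum hy using 2 with n
    split_ifs with h
    · simp [hp n h y]
    · rfl
  · intro j hj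
    simp [hj]
  · simp

/-- A function whose power series at `0` has no constant term is obtained by evaluating an
operator-valued analytic function at the variable. -/
theorem HasFPowerSeriesAt.exists_shift [CompleteSpace F] {f : E → F}
    {p : FormalMultilinearSeries 𝕜 E F} (hf : HasFPowerSeriesAt f p 0) (hp : p 0 = 0) :
    ∃ g : E → E →L[𝕜] F, HasFPowerSeriesAt g p.shift 0 ∧ ∀ᶠ z in 𝓝 0, f z = g z z := by
  obtain ⟨r, hr⟩ := hf
  have hrad : r ≤ p.shift.radius := by simpa using hr.r_le
  have hg := p.shift.hasFPowerSeriesOnBall (hr.r_pos.trans_le hrad)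
  refine ⟨p.shift.sum, ⟨_, hg⟩, ?_⟩
  filter_upwards [Metric.eball_mem_nhds (0 : E) hr.r_pos] with z hz
  have hfz := hr.hasSum hz
  have hgz := hg.hasSum (Metric.eball_subset_eball hrad hz)
  rw [zero_add] at hfz hgz
  have hgz' := (ContinuousLinearMap.apply 𝕜 F z).hasSum hgz
  rw [← hasSum_nat_add_iff' 1] at hfz
  simp only [Finset.range_one, Finset.sum_singleton, hp, zero_apply,
    sub_zero] at hfz
  refine hfz.unique ?_
  simp only [ContinuousLinearMap.apply_apply] at hgz'
  convert hgz' using 2 with n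
  simp only [FormalMultilinearSeries.shift,
    ContinuousMultilinearMap.curryRight_apply]
  congr 1
  ext i
  refine Fin.lastCases ?_ (fun j => ?_) i <;> simp

end PowerSeries

section Pencil

variable {N : ℕ} {E F : Type*} [NormedAddCommGroup E] [NormedAddCommGroup F]

theorem pencil_isBigO [NormedSpace ℂ E] [NormedSpace ℂ F] (T : Fin N → (E →L[ℂ] F)) :
    (fun z => pencil T z) =O[𝓝 0] fun z : Fin N → ℂ => ‖z‖ := by
  refine IsBigO.of_bound (∑ k, ‖T k‖) (Eventually.of_forall fun z => ?_)
  rw [pencil, norm_norm, Finset.sum_mul]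
  refine norm_sum_le_of_le _ fun k _ => ?_
  rw [norm_smul, mul_comm]
  gcongr
  exact norm_le_pi_norm z k

theorem chainMulR_isBigO {Usp : ℕ → Type*} [∀ j, NormedAddCommGroup (Usp j)]
    [∀ j, NormedSpace ℂ (Usp j)] (R : (j : ℕ) → Fin N → (Usp j →L[ℂ] Usp (j + 1))) (m : ℕ) :
    (fun z => chainMulR R z m) =O[𝓝 0] fun z : Fin N → ℂ => ‖z‖ ^ m := by
  induction m with
  | zero =>
    simp only [chainMulR, pow_zero]
    exact isBigO_const_const _ one_ne_zero _
  | succ m ih =>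
    refine (IsBigO.of_bound' (Eventually.of_forall fun z => ?_)).trans
      (((pencil_isBigO (R m)).norm_left.mul ih.norm_left).congr_right fun z => (pow_succ' _ _).symm)
    rw [Real.norm_of_nonneg (by positivity)]
    exact ContinuousLinearMap.opNorm_comp_le _ _

/-- The inclusion of the `k`-th summand into the Hilbert space direct sum of `N` copies of `E`. -/
def inclPiLp [NormedSpace ℂ E] (k : Fin N) : E →L[ℂ] PiLp 2 (fun _ : Fin N => E) :=
  ((PiLp.continuousLinearEquiv 2 ℂ (fun _ : Fin N => E)).symm :
    (Fin N → E) →L[ℂ] PiLp 2 (fun _ : Fin N => E)).comp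
      (ContinuousLinearMap.single ℂ (fun _ : Fin N => E) k)

/-- The row operator `(u_k)ₖ ↦ Σₖ A(eₖ) u_k` built from an operator-valued linear map `A`. -/
def rowOp (N : ℕ) (E F : Type*) [NormedAddCommGroup E] [NormedAddCommGroup F]
    [NormedSpace ℂ E] [NormedSpace ℂ F] :
    ((Fin N → ℂ) →L[ℂ] (E →L[ℂ] F)) →L[ℂ] (PiLp 2 (fun _ : Fin N => E) →L[ℂ] F) :=
  ∑ k, (((ContinuousLinearMap.compL ℂ (PiLp 2 (fun _ : Fin N => E)) E F).flip
    (PiLp.proj 2 (fun _ : Fin N => E) k)).comp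
      (ContinuousLinearMap.apply ℂ (E →L[ℂ] F) (Pi.single k (1 : ℂ))))

theorem rowOp_comp_pencil [NormedSpace ℂ E] [NormedSpace ℂ F]
    (A : (Fin N → ℂ) →L[ℂ] (E →L[ℂ] F)) (z : Fin N → ℂ) :
    (rowOp N E F A).comp (pencil inclPiLp z) = A z := by
  ext u
  have hz : z = ∑ k, z k • Pi.single k (1 : ℂ) := by
    simpa using pi_eq_sum_univ' z
  have hu : ∀ k, (pencil inclPiLp z u : PiLp 2 (fun _ : Fin N => E)) k = z k • u := by
    intro k
    simp [pencil, inclPiLp, Pi.single_apply, smul_ite]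
  conv_rhs => rw [hz]
  simp [rowOp, hu]

/-- An operator-valued analytic function vanishing at `0` factors through the pencil of coordinate
inclusions, with the order of vanishing lowered by one. -/
theorem HasFPowerSeriesAt.exists_factor_inclPiLp [NormedSpace ℂ E] [NormedSpace ℂ F]
    [CompleteSpace F] {f : (Fin N → ℂ) → (E →L[ℂ] F)}
    {p : FormalMultilinearSeries ℂ (Fin N → ℂ) (E →L[ℂ] F)} (hf : HasFPowerSeriesAt f p 0)
    (hp : p 0 = 0) :
    ∃ (φ : (Fin N → ℂ) → (PiLp 2 (fun _ : Fin N => E) →L[ℂ] F))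
      (q : FormalMultilinearSeries ℂ (Fin N → ℂ) (PiLp 2 (fun _ : Fin N => E) →L[ℂ] F)),
      HasFPowerSeriesAt φ q 0 ∧ (∀ i, p (i + 1) = 0 → q i = 0) ∧
        ∀ᶠ z in 𝓝 0, f z = (φ z).comp (pencil inclPiLp z) := by
  obtain ⟨g, ⟨r, hr⟩, hgz⟩ := hf.exists_shift hp
  refine ⟨rowOp N E F ∘ g, (rowOp N E F).compFormalMultilinearSeries p.shift,
    ⟨r, (rowOp N E F).comp_hasFPowerSeriesOnBall hr⟩, fun i hi => ?_, ?_⟩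
  · have hz : p.shift i = 0 := by
      simp only [FormalMultilinearSeries.shift, Nat.succ_eq_add_one, hi]
      rfl
    rw [ContinuousLinearMap.compFormalMultilinearSeries_apply, hz]
    ext v : 1
    exact map_zero (rowOp N E F)
  · filter_upwards [hgz] with z hz
    rw [hz, Function.comp_apply, rowOp_comp_pencil]

end Pencil

/-- The Hilbert space direct sum of `N` copies of a separable Hilbert space. -/
def HilbertSp.copies (N : ℕ) (H : HilbertSp) : HilbertSp :=
  haveI : TopologicalSpace.SeparableSpace (PiLp 2 (fun _ : Fin N => H.carrier)) :=
    (PiLp.continuousLinearEquiv 2 ℂ (fun _ : Fin N => H.carrier)).symm.surjective.denseRange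
      |>.separableSpace (PiLp.continuousLinearEquiv 2 ℂ (fun _ : Fin N => H.carrier)).symm.continuous
  ⟨PiLp 2 (fun _ : Fin N => H.carrier)⟩

/-- The iterated direct sums `U, U^N, (U^N)^N, …`. -/
def HilbertSp.iterCopies (N : ℕ) (H : HilbertSp) : ℕ → HilbertSp
  | 0 => H
  | j + 1 => (HilbertSp.iterCopies N H j).copies N

/-- The coordinate inclusions between consecutive iterated direct sums. -/
def HilbertSp.iterIncl (N : ℕ) (H : HilbertSp) (j : ℕ) (k : Fin N) :
    (H.iterCopies N j).carrier →L[ℂ] (H.iterCopies N (j + 1)).carrier :=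
  inclPiLp k

/-- One coordinate pencil can be extracted for each vanishing term of the power series. -/
theorem HilbertSp.exists_factor_iterIncl {N : ℕ} (H : HilbertSp) {Y : Type*}
    [NormedAddCommGroup Y] [NormedSpace ℂ Y] [CompleteSpace Y]
    {θ : (Fin N → ℂ) → (H.carrier →L[ℂ] Y)}
    {p : FormalMultilinearSeries ℂ (Fin N → ℂ) (H.carrier →L[ℂ] Y)}
    (hθ : HasFPowerSeriesAt θ p 0) {m : ℕ} (hp : ∀ i < m, p i = 0) (j : ℕ) (hj : j ≤ m) :
    ∃ (ψ : (Fin N → ℂ) → ((H.iterCopies N j).carrier →L[ℂ] Y))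
      (q : FormalMultilinearSeries ℂ (Fin N → ℂ) ((H.iterCopies N j).carrier →L[ℂ] Y)),
      HasFPowerSeriesAt ψ q 0 ∧ (∀ i, i + j < m → q i = 0) ∧
        ∀ᶠ z in 𝓝 0, θ z = (ψ z).comp
          (chainMulR (Usp := fun j => (H.iterCopies N j).carrier) (H.iterIncl N) z j) := by
  induction j with
  | zero => exact ⟨θ, p, hθ, hp, Eventually.of_forall fun z => rfl⟩
  | succ j ih =>
    obtain ⟨ψ, q, hψ, hq, hfac⟩ := ih (by lia)
    obtain ⟨φ, s, hφ, hs, hψφ⟩ := hψ.exists_factor_inclPiLp (hq 0 (by lia))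
    refine ⟨φ, s, hφ, fun i hi => hs i (hq (i + 1) (by lia)), ?_⟩
    filter_upwards [hfac, hψφ] with z hz hz'
    rw [hz, hz']
    rfl

/-- If `θ = ψ · Θ` with `ψ` analytic, `ψ 0 = 0` and `Θ = O(‖z‖ ^ m)`, then the degree `m` term of
`θ` vanishes as soon as the lower ones do. -/
theorem diag_eq_zero_of_factor {V U W Y : Type*} [NormedAddCommGroup V] [NormedSpace ℂ V]
    [NormedAddCommGroup U] [NormedSpace ℂ U] [NormedAddCommGroup W] [NormedSpace ℂ W]
    [NormedAddCommGroup Y] [NormedSpace ℂ Y]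
    {θ : V → (U →L[ℂ] Y)} {p : FormalMultilinearSeries ℂ V (U →L[ℂ] Y)}
    (hθ : HasFPowerSeriesAt θ p 0) {m : ℕ} (hp : ∀ i < m, p i = 0)
    {ψ : V → (W →L[ℂ] Y)} {Θ : V → (U →L[ℂ] W)} (hψ : AnalyticAt ℂ ψ 0) (hψ0 : ψ 0 = 0)
    (hΘ : Θ =O[𝓝 0] fun z => ‖z‖ ^ m) (hfac : ∀ᶠ z in 𝓝 0, θ z = (ψ z).comp (Θ z)) (z : V) :
    p m (fun _ => z) = 0 := by
  refine IsBigO.continuousMultilinearMap_apply_eq_zero ?_ z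
  have hψO : ψ =O[𝓝 0] fun z => ‖z‖ := by
    simpa [hψ0] using hψ.differentiableAt.isBigO_sub.norm_right
  have hθO : θ =O[𝓝 0] fun z => ‖z‖ ^ (m + 1) := by
    refine (IsBigO.of_bound' ?_).trans
      ((hψO.norm_left.mul hΘ.norm_left).congr_right fun z => (pow_succ' _ _).symm)
    filter_upwards [hfac] with z hz
    rw [hz, Real.norm_of_nonneg (by positivity)]
    exact ContinuousLinearMap.opNorm_comp_le _ _
  have hsum : ∀ z, p.partialSum (m + 1) z = p m fun _ => z := by
    intro z
    rw [FormalMultilinearSeries.partialSum, Finset.sum_range_succ, Finset.sum_eq_zero, zero_add]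
    intro i hi
    simp [hp i (Finset.mem_range.mp hi)]
  have := hθO.sub (hθ.isBigO_sub_partialSum_pow (m + 1))
  simpa [hsum] using this

/-- Theorem `thm:right`: right-hand analogue of the linear-factor extraction
theorem: `θ(z) = ψ(z) (zR⁽ᵐ⁾) ⋯ (zR⁽¹⁾)` near `0`, with `ψ(0) ≠ 0`. -/
theorem right_linear_factor_extraction {N m : ℕ} {U Y : Type}
    [NormedAddCommGroup U] [InnerProductSpace ℂ U] [CompleteSpace U]
    [TopologicalSpace.SeparableSpace U]
    [NormedAddCommGroup Y] [InnerProductSpace ℂ Y] [CompleteSpace Y]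
    [TopologicalSpace.SeparableSpace Y]
    (θ : (Fin N → ℂ) → (U →L[ℂ] Y)) (hm : 0 < m) (hθ : HasZeroOfOrder θ m) :
    ∃ (Usp : ℕ → HilbertSp) (e : U ≃ₗᵢ[ℂ] (Usp 0).carrier)
      (R : (j : ℕ) → Fin N → ((Usp j).carrier →L[ℂ] (Usp (j + 1)).carrier))
      (ψ : (Fin N → ℂ) → ((Usp m).carrier →L[ℂ] Y)),
      AnalyticAt ℂ ψ 0 ∧ ψ 0 ≠ 0 ∧
        ∀ᶠ z in nhds 0, θ z =
          ((ψ z).comp (chainMulR (Usp := fun j => (Usp j).carrier) R z m)).comp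
            e.toLinearIsometry.toContinuousLinearMap := by
  obtain ⟨p, hp, hlow, z, hz⟩ := hθ
  obtain ⟨q, hq, hq0, hqm⟩ := hp.exists_eq_zero_of_diag_eq_zero hlow
  let H : HilbertSp := ⟨U⟩
  obtain ⟨ψ, s, hψ, -, hfac⟩ := H.exists_factor_iterIncl hq hq0 m le_rfl
  refine ⟨H.iterCopies N, LinearIsometryEquiv.refl ℂ U, H.iterIncl N, ψ, hψ.analyticAt, ?_, hfac⟩
  intro h0
  refine hz ?_
  rw [← hqm]
  exact diag_eq_zero_of_factor hq hq0 hψ.analyticAt h0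
    (chainMulR_isBigO (Usp := fun j => (H.iterCopies N j).carrier) (H.iterIncl N) m) hfac z
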